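/- arXiv:1211.4517 — 3 statements merged into one kernel-verified Lean document; each statement's English description precedes it below -/
import Mathlib

section
/- Let (A,I) be a finite independence alphabet. Then for every endomorphism φ of the trace monoid M(A,I), the set Fix φ of fixed points of φ is a finitely generated submonoid of M(A,I). -/
/-- The defining relation of the trace monoid: `ab = ba` whenever `(a,b) ∈ I`. -/
def traceRel (A : Type) (I : A → A → Prop) : FreeMonoid A → FreeMonoid A → Prop :=
  fun x y => ∃ a b : A, I a b ∧ x = FreeMonoid.of a * FreeMonoid.of b ∧
    y = FreeMonoid.of b * FreeMonoid.of a

/-- The congruence on the free monoid generated by the trace relations. -/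
def traceCon (A : Type) (I : A → A → Prop) : Con (FreeMonoid A) :=
  conGen (traceRel A I)

/-- The trace monoid `M(A,I)`, the quotient of the free monoid on `A` by the
congruence generated by `{(ab, ba) : (a,b) ∈ I}`. -/
abbrev TraceMonoid (A : Type) (I : A → A → Prop) := (traceCon A I).Quotient

/-- The submonoid of fixed points of an endomorphism. -/
def fixedSubmonoid {M : Type*} [Monoid M] (φ : M →* M) : Submonoid M where
  carrier := {x | φ x = x}
  mul_mem' := by
    intro a b ha hb
    simp only [Set.mem_setOf_eq] at *
    rw [map_mul, ha, hb]
  one_mem' := map_one φ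

namespace TraceMonoid

variable {A : Type} {I : A → A → Prop}

/-- The trace consisting of a single letter. -/
def of (a : A) : TraceMonoid A I := ((FreeMonoid.of a : FreeMonoid A) : (traceCon A I).Quotient)

theorem commute_of {a b : A} (h : I a b) : Commute (of a : TraceMonoid A I) (of b) :=
  (Con.eq _).2 (Con.le_conGen _ _ ⟨a, b, h, rfl, rfl⟩)

theorem induction_cons {P : TraceMonoid A I → Prop} (one : P 1)
    (cons : ∀ a x, P x → P (of a * x)) (x : TraceMonoid A I) : P x := by
  induction x using Con.induction_on with
  | H u =>
    induction u using FreeMonoid.inductionOn' with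
    | one => exact one
    | of_mul a u ih => exact cons a _ ih

/-- The universal property of the trace monoid. -/
def lift {N : Type*} [Monoid N] (f : A → N) (hf : ∀ a b, I a b → Commute (f a) (f b)) :
    TraceMonoid A I →* N :=
  (traceCon A I).lift (FreeMonoid.lift f) <| Con.conGen_le.2 <| by
    rintro _ _ ⟨a, b, hab, rfl, rfl⟩
    simpa [Con.ker_rel] using (hf a b hab).eq

@[simp]
theorem lift_of {N : Type*} [Monoid N] (f : A → N) (hf : ∀ a b, I a b → Commute (f a) (f b))
    (a : A) : lift f hf (of a) = f a :=
  (Con.lift_coe _ _).trans (FreeMonoid.lift_eval_of f a)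

/-- The multiset of letters of a trace, as a monoid homomorphism. -/
def lettersHom : TraceMonoid A I →* Multiplicative (Multiset A) :=
  lift (fun a => Multiplicative.ofAdd {a}) fun _ _ _ => Commute.all _ _

/-- The multiset of letters of a trace. -/
def letters (x : TraceMonoid A I) : Multiset A := (lettersHom x).toAdd

@[simp]
theorem letters_one : letters (1 : TraceMonoid A I) = 0 := by simp [letters]

@[simp]
theorem letters_mul (x y : TraceMonoid A I) : letters (x * y) = letters x + letters y := by
  simp [letters]

@[simp]
theorem letters_of (a : A) : letters (of a : TraceMonoid A I) = {a} := by
  simp [letters, lettersHom]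

theorem letters_eq_zero {x : TraceMonoid A I} : letters x = 0 ↔ x = 1 := by
  refine ⟨fun h => ?_, fun h => by simp [h]⟩
  induction x using induction_cons with
  | one => rfl
  | cons a x ih => simp at h

theorem eq_of_letters_eq {x : TraceMonoid A I} {b : A} (h : letters x = {b}) : x = of b := by
  induction x using induction_cons with
  | one => simp at h
  | cons a x ih =>
    rw [letters_mul, letters_of, Multiset.singleton_add, eq_comm,
      Multiset.singleton_eq_cons_iff] at h
    rw [letters_eq_zero.1 h.2, ← h.1, mul_one]

theorem mul_eq_one {x y : TraceMonoid A I} : x * y = 1 ↔ x = 1 ∧ y = 1 := by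
  simp [← letters_eq_zero]

theorem map_of_eq_one {N : Type*} [Monoid N] (hN : ∀ x y : N, x * y = 1 → x = 1 ∧ y = 1)
    (f : TraceMonoid A I →* N) {x : TraceMonoid A I} (h : f x = 1) :
    ∀ a ∈ letters x, f (of a) = 1 := by
  induction x using induction_cons with
  | one => simp
  | cons a x ih =>
    rw [map_mul] at h
    have := hN _ _ h
    simpa [this.1] using ih this.2

theorem map_eq_one {N : Type*} [Monoid N] (f : TraceMonoid A I →* N) {x : TraceMonoid A I}
    (h : ∀ a ∈ letters x, f (of a) = 1) : f x = 1 := by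
  induction x using induction_cons with
  | one => simp
  | cons a x ih =>
    simp only [letters_mul, letters_of, Multiset.singleton_add, Multiset.mem_cons,
      forall_eq_or_imp] at h
    rw [map_mul, h.1, ih h.2, one_mul]

theorem letters_map (f : TraceMonoid A I →* TraceMonoid A I) (x : TraceMonoid A I) :
    letters (f x) = (letters x).bind fun a => letters (f (of a)) := by
  induction x using induction_cons with
  | one => simp
  | cons a x ih => simp [ih]

section Erase

variable [DecidableEq A]

theorem erase_congr (b : A) {u v : List A} (h : traceCon A I (FreeMonoid.ofList u)
      (FreeMonoid.ofList v)) :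
    ((FreeMonoid.ofList (u.erase b) : FreeMonoid A) : (traceCon A I).Quotient) =
      (FreeMonoid.ofList (v.erase b) : FreeMonoid A) := by
  suffices H : ∀ u v : FreeMonoid A, ConGen.Rel (traceRel A I) u v →
      (b ∈ u.toList ↔ b ∈ v.toList) ∧
      ((FreeMonoid.ofList (u.toList.erase b) : FreeMonoid A) : (traceCon A I).Quotient) =
        (FreeMonoid.ofList (v.toList.erase b) : FreeMonoid A) from (H _ _ h).2
  intro u v h
  induction h with
  | of u v h =>
    obtain ⟨c, d, hcd, rfl, rfl⟩ := h
    refine ⟨by simp [or_comm], ?_⟩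
    by_cases hc : c = b
    · by_cases hd : d = b
      · subst hc hd; rfl
      · subst hc
        simp [hd]
    · by_cases hd : d = b
      · subst hd
        simp [hc]
      · have := (commute_of hcd : Commute (of c : TraceMonoid A I) (of d)).eq
        simpa [List.erase_cons, hc, hd, FreeMonoid.ofList_cons, of] using this
  | refl u => exact ⟨Iff.rfl, rfl⟩
  | symm _ ih => exact ⟨ih.1.symm, ih.2.symm⟩
  | trans _ _ ih₁ ih₂ => exact ⟨ih₁.1.trans ih₂.1, ih₁.2.trans ih₂.2⟩
  | @mul u v u' v' h₁ h₂ ih₁ ih₂ =>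
    refine ⟨by simp [ih₁.1, ih₂.1], ?_⟩
    have e₁ : (u : (traceCon A I).Quotient) = v := (Con.eq _).2 h₁
    have e₂ : (u' : (traceCon A I).Quotient) = v' := (Con.eq _).2 h₂
    simp only [FreeMonoid.toList_mul, List.erase_append]
    by_cases hb : b ∈ u.toList
    · rw [if_pos hb, if_pos (ih₁.1.1 hb)]
      simp [FreeMonoid.ofList_append, ih₁.2, e₂]
    · rw [if_neg hb, if_neg (mt ih₁.1.2 hb)]
      simp [FreeMonoid.ofList_append, ih₂.2, e₁]

/-- Delete the first occurrence of the letter `b` in a trace. -/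
def erase (b : A) (x : TraceMonoid A I) : TraceMonoid A I :=
  Con.liftOn x
    (fun u => ((FreeMonoid.ofList (u.toList.erase b) : FreeMonoid A) : (traceCon A I).Quotient))
    fun _ _ h => erase_congr b h

theorem erase_of_mul_self (b : A) (x : TraceMonoid A I) : erase b (of b * x) = x := by
  induction x using Con.induction_on with
  | H u =>
    rw [of, ← Con.coe_mul, erase, Con.liftOn_coe]
    simp

theorem erase_of_mul_of_ne {a b : A} (h : a ≠ b) (x : TraceMonoid A I) :
    erase b (of a * x) = of a * erase b x := by
  induction x using Con.induction_on with
  | H u =>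
    rw [of, ← Con.coe_mul, erase, Con.liftOn_coe, erase, Con.liftOn_coe, ← Con.coe_mul]
    simp [h, FreeMonoid.ofList_cons]

end Erase

theorem of_mul_left_cancel {a : A} {x y : TraceMonoid A I} (h : of a * x = of a * y) : x = y := by
  classical
  rw [← erase_of_mul_self a x, h, erase_of_mul_self]

theorem prod_of_mul_left_cancel {l : List A} {x y : TraceMonoid A I}
    (h : (l.map of).prod * x = (l.map of).prod * y) : x = y := by
  induction l with
  | nil => simpa using h
  | cons a l ih =>
    simp only [List.map_cons, List.prod_cons, mul_assoc] at h
    exact ih (of_mul_left_cancel h)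

theorem exists_eq_of_mul {a b : A} (hab : a ≠ b) {x y : TraceMonoid A I}
    (h : of a * x = of b * y) : ∃ z, x = of b * z := by
  classical
  refine ⟨erase b x, ?_⟩
  have hy : of a * erase b x = y := by
    rw [← erase_of_mul_of_ne hab, h, erase_of_mul_self]
  rw [← hy] at h
  rw [← erase_of_mul_self a x, h, erase_of_mul_of_ne hab.symm, erase_of_mul_self,
    erase_of_mul_self]

theorem indep_of_mul_eq (hsym : ∀ a b, I a b → I b a) {a b : A} (hab : a ≠ b)
    {x y : TraceMonoid A I}
    (h : of a * x = of b * y) : I a b := by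
  classical
  by_contra hI
  have hI' : ¬ I b a := fun h => hI (hsym _ _ h)
  let p : TraceMonoid A I →* FreeMonoid A :=
    lift (fun c => if c = a ∨ c = b then FreeMonoid.of c else 1) <| by
      intro c d hcd
      split_ifs with hc hd
      · rcases hc with rfl | rfl <;> rcases hd with rfl | rfl
        · exact Commute.refl _
        · exact absurd hcd hI
        · exact absurd hcd hI'
        · exact Commute.refl _
      all_goals simp
  have hp := congrArg (fun z => (p z).toList) h
  simp [p, hab] at hp

theorem exists_eq_prod_of_mul {l : List A} (hl : l.Nodup) {w : TraceMonoid A I}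
    (h : ∀ a ∈ l, ∃ x, w = of a * x) : ∃ x, w = (l.map of).prod * x := by
  induction l generalizing w with
  | nil => exact ⟨w, by simp⟩
  | cons a l ih =>
    obtain ⟨x, rfl⟩ := h a (by simp)
    rw [List.nodup_cons] at hl
    obtain ⟨z, rfl⟩ := ih hl.2 (w := x) fun b hb => by
      obtain ⟨y, hy⟩ := h b (by simp [hb])
      exact exists_eq_of_mul (ne_of_mem_of_not_mem hb hl.1).symm hy
    exact ⟨z, by simp [mul_assoc]⟩

/-- A nontrivial fixed point of an endomorphism that maps the letters of its fixed points to
letters starts with a fixed point which is a product of distinct letters. -/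
theorem exists_fixed_prod_mul [Fintype A] (hsym : ∀ a b, I a b → I b a)
    {ψ : TraceMonoid A I →* TraceMonoid A I} {w : TraceMonoid A I} (hw : ψ w = w)
    (hψ : ∀ a ∈ letters w, ∃ b, ψ (of a) = of b) (hne : w ≠ 1) :
    ∃ (s : Finset A) (x : TraceMonoid A I), s.Nonempty ∧ w = (s.toList.map of).prod * x ∧
      ψ (s.toList.map of).prod = (s.toList.map of).prod := by
  classical
  let s : Finset A := Finset.univ.filter fun a => ∃ x, w = of a * x
  have hs : ∀ a, a ∈ s ↔ ∃ x, w = of a * x := by simp [s]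
  have hsw : ∀ a ∈ s, a ∈ letters w := by
    intro a ha
    obtain ⟨x, rfl⟩ := (hs a).1 ha
    simp
  have : ∃ σ : A → A, ∀ a ∈ letters w, ψ (of a) = of (σ a) := by
    choose! σ hσ using hψ
    exact ⟨σ, hσ⟩
  obtain ⟨σ, hσ⟩ := this
  have hmap : (letters w).map σ = letters w := by
    conv_rhs => rw [← hw, letters_map]
    rw [← Multiset.bind_singleton]
    refine Multiset.bind_congr fun a ha => ?_
    rw [hσ a ha, letters_of]
  have hinj : Set.InjOn σ (letters w).toFinset := by
    rw [← Finset.card_image_iff]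
    rw [← Multiset.toFinset_map, hmap]
  have hσs : s.image σ = s := by
    refine Finset.eq_of_subset_of_card_le ?_ ?_
    · intro b hb
      obtain ⟨a, ha, rfl⟩ := Finset.mem_image.1 hb
      obtain ⟨x, hx⟩ := (hs a).1 ha
      refine (hs _).2 ⟨ψ x, ?_⟩
      rw [← hσ a (hsw a ha), ← map_mul, ← hx, hw]
    · rw [Finset.card_image_of_injOn]
      exact hinj.mono fun a ha => by simpa using hsw a ha
  have hcomm : ∀ a ∈ s, ∀ b ∈ s, Commute (of a : TraceMonoid A I) (of b) := by
    intro a ha b hb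
    by_cases hab : a = b
    · rw [hab]
    · obtain ⟨x, hx⟩ := (hs a).1 ha
      obtain ⟨y, hy⟩ := (hs b).1 hb
      exact commute_of (indep_of_mul_eq hsym hab (hx.symm.trans hy))
  obtain ⟨x, hx⟩ := exists_eq_prod_of_mul (w := w) s.nodup_toList fun a ha =>
    (hs a).1 (Finset.mem_toList.1 ha)
  refine ⟨s, x, ?_, hx, ?_⟩
  · induction w using induction_cons with
    | one => exact absurd rfl hne
    | cons a y _ => exact ⟨a, (hs a).2 ⟨y, rfl⟩⟩
  · have hperm : (s.toList.map σ).Perm s.toList := by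
      rw [List.perm_ext_iff_of_nodup _ s.nodup_toList]
      · intro b
        conv_rhs => rw [Finset.mem_toList, ← hσs]
        simp
      · refine s.nodup_toList.map_on fun a ha b hb h => hinj ?_ ?_ h
        · simpa using hsw a (Finset.mem_toList.1 ha)
        · simpa using hsw b (Finset.mem_toList.1 hb)
    have e : ψ (s.toList.map of).prod = ((s.toList.map σ).map of).prod := by
      rw [map_list_prod, List.map_map, List.map_map]
      congr 1
      exact List.map_congr_left fun a ha => hσ a (hsw a (Finset.mem_toList.1 ha))
    rw [e]
    refine ((hperm.symm.map of).prod_eq' ?_).symm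
    refine List.pairwise_of_forall_mem_list ?_
    intro u hu v hv
    obtain ⟨a, ha, rfl⟩ := List.mem_map.1 hu
    obtain ⟨b, hb, rfl⟩ := List.mem_map.1 hv
    exact hcomm a (Finset.mem_toList.1 ha) b (Finset.mem_toList.1 hb)

theorem fixedSubmonoid_fg_of_letters [Fintype A] (hsym : ∀ a b, I a b → I b a)
    (ψ : TraceMonoid A I →* TraceMonoid A I)
    (hψ : ∀ w, ψ w = w → ∀ a ∈ letters w, ∃ b, ψ (of a) = of b) : (fixedSubmonoid ψ).FG := by
  let S : Set (TraceMonoid A I) :=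
    {x | ψ x = x} ∩ Set.range fun s : Finset A => (s.toList.map of).prod
  refine (Submonoid.fg_iff _).2 ⟨S, le_antisymm ?_ ?_, (Set.finite_range _).inter_of_right _⟩
  · exact Submonoid.closure_le.2 fun x hx => hx.1
  · intro w hw
    change ψ w = w at hw
    induction hn : (letters w).card using Nat.strong_induction_on generalizing w with
    | _ n ih =>
      by_cases hne : w = 1
      · rw [hne]
        exact one_mem _
      obtain ⟨s, x, ⟨a, ha⟩, hx, hs⟩ := exists_fixed_prod_mul hsym hw (hψ w hw) hne
      have hψx : ψ x = x := by
        rw [hx, map_mul, hs] at hw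
        exact prod_of_mul_left_cancel hw
      rw [hx]
      refine mul_mem (Submonoid.subset_closure ⟨hs, s, rfl⟩) (ih _ ?_ hψx rfl)
      rw [← hn, hx, letters_mul, Multiset.card_add, Nat.lt_add_left_iff_pos, Multiset.card_pos,
        Ne, letters_eq_zero]
      obtain ⟨l, l', hl⟩ := List.append_of_mem (Finset.mem_toList.2 ha)
      rw [hl, ← letters_eq_zero]
      simp

theorem exists_map_of_eq_of {ψ : TraceMonoid A I →* TraceMonoid A I} {w : TraceMonoid A I}
    (hw : ψ w = w) (hψ : ∀ a ∈ letters w, ψ (of a) ≠ 1) :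
    ∀ a ∈ letters w, ∃ b, ψ (of a) = of b := by
  intro a ha
  obtain ⟨t, ht⟩ := Multiset.exists_cons_of_mem ha
  have hle : ∀ c ∈ letters w, 1 ≤ (letters (ψ (of c))).card := fun c hc =>
    Multiset.card_pos.2 (mt letters_eq_zero.1 (hψ c hc))
  have hcard := congrArg (fun x => (letters x).card) hw
  simp only [letters_map ψ w, Multiset.card_bind] at hcard
  rw [ht, Multiset.map_cons, Multiset.sum_cons, Multiset.card_cons] at hcard
  have h₁ := hle a ha
  have h₂ : t.card ≤ (t.map (Multiset.card ∘ fun c => letters (ψ (of c)))).sum := by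
    have := Multiset.card_nsmul_le_sum
      (s := t.map (Multiset.card ∘ fun c => letters (ψ (of c)))) (a := 1) (by
        intro n hn
        obtain ⟨c, hc, rfl⟩ := Multiset.mem_map.1 hn
        exact hle c (ht ▸ Multiset.mem_cons_of_mem hc))
    simpa using this
  obtain ⟨b, hb⟩ := Multiset.card_eq_one.1 (show (letters (ψ (of a))).card = 1 by
    simp only [Function.comp_apply] at hcard h₂; omega)
  exact ⟨b, eq_of_letters_eq hb⟩

open Classical in
/-- The endomorphism of the trace monoid that deletes the letters satisfying `p`. -/
noncomputable def delete (p : A → Prop) : TraceMonoid A I →* TraceMonoid A I :=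
  lift (fun a => if p a then 1 else of a) fun a b h => by
    split_ifs <;> simp [commute_of h]

theorem delete_of_pos {p : A → Prop} {a : A} (h : p a) :
    delete p (of a : TraceMonoid A I) = 1 := by simp [delete, h]

theorem delete_of_neg {p : A → Prop} {a : A} (h : ¬ p a) :
    delete p (of a : TraceMonoid A I) = of a := by simp [delete, h]

theorem not_of_mem_letters_delete {p : A → Prop} (x : TraceMonoid A I) :
    ∀ a ∈ letters (delete p x), ¬ p a := by
  induction x using induction_cons with
  | one => simp
  | cons b x ih =>
    intro a ha
    rw [map_mul, letters_mul, Multiset.mem_add] at ha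
    by_cases hb : p b
    · rw [delete_of_pos hb] at ha
      exact ih a (by simpa using ha)
    · rw [delete_of_neg hb, letters_of, Multiset.mem_singleton] at ha
      rcases ha with rfl | ha
      · exact hb
      · exact ih a ha

theorem map_delete {N : Type*} [Monoid N] {p : A → Prop} {f : TraceMonoid A I →* N}
    (hf : ∀ a, p a → f (of a) = 1) (x : TraceMonoid A I) : f (delete p x) = f x := by
  induction x using induction_cons with
  | one => simp
  | cons a x ih =>
    rw [map_mul, map_mul, map_mul, ih]
    by_cases ha : p a
    · rw [delete_of_pos ha, hf a ha, map_one]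
    · rw [delete_of_neg ha]

theorem exists_pow_map_of_eq_one [Finite A] (φ : Monoid.End (TraceMonoid A I)) :
    ∃ n, ∀ a k, (φ ^ k) (of a) = 1 → (φ ^ n) (of a) = 1 := by
  classical
  cases nonempty_fintype A
  have : ∀ a, ∃ n, ∀ k, (φ ^ k) (of a) = 1 → (φ ^ n) (of a) = 1 := fun a => by
    by_cases h : ∃ k, (φ ^ k) (of a) = 1
    · exact ⟨h.choose, fun _ _ => h.choose_spec⟩
    · exact ⟨0, fun k hk => absurd ⟨k, hk⟩ h⟩
  choose n hn using this
  refine ⟨∑ a, n a, fun a k hk => ?_⟩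
  rw [← Nat.sub_add_cancel (Finset.single_le_sum (f := n) (fun _ _ => Nat.zero_le _)
    (Finset.mem_univ a)), pow_add, Monoid.End.coe_mul, Function.comp_apply, hn a k hk, map_one]

end TraceMonoid

open TraceMonoid

/-- For a finite independence alphabet `(A,I)`, the fixed point submonoid of any
endomorphism of the trace monoid `M(A,I)` is finitely generated. -/
theorem fix_fg (A : Type) [Fintype A] (I : A → A → Prop)
    (hsym : Symmetric I) (hirr : Irreflexive I)
    (φ : TraceMonoid A I →* TraceMonoid A I) :
    (fixedSubmonoid φ).FG := by
  let f : Monoid.End (TraceMonoid A I) := φ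
  obtain ⟨n, hn⟩ := exists_pow_map_of_eq_one f
  have hcomm : ∀ x, (f ^ n) (φ x) = φ ((f ^ n) x) := fun x =>
    DFunLike.congr_fun ((Commute.refl f).pow_left n).eq x
  let p : A → Prop := fun a => (f ^ n) (of a) = 1
  let ψ : TraceMonoid A I →* TraceMonoid A I := (delete p).comp φ
  have hdel : ∀ x, (f ^ n) (delete p x) = (f ^ n) x := map_delete fun a ha => ha
  have hψ : ∀ x, ψ (delete p x) = ψ x := map_delete fun a ha => by
    refine map_eq_one (delete p) fun b hb => delete_of_pos ?_
    refine map_of_eq_one (fun x y => mul_eq_one.1) (f ^ n) ?_ b hb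
    exact (hcomm _).trans ((congrArg φ ha).trans (map_one φ))
  have hfg : (fixedSubmonoid ψ).FG := by
    refine fixedSubmonoid_fg_of_letters (fun _ _ h => hsym h) ψ fun w hw =>
      exists_map_of_eq_of hw fun a ha h => ?_
    rw [← hw] at ha
    refine not_of_mem_letters_delete _ a ha (hn a (n + 1) ?_)
    rw [pow_succ, Monoid.End.coe_mul, Function.comp_apply, ← hdel]
    exact (congrArg (f ^ n) h).trans (map_one _)
  have hmap : fixedSubmonoid φ = (fixedSubmonoid ψ).map (f ^ n) := by
    ext w
    rw [Submonoid.mem_map]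
    constructor
    · intro hw
      change φ w = w at hw
      refine ⟨delete p w, (hψ w).trans (congrArg (delete p) hw), ?_⟩
      rw [hdel, Monoid.End.coe_pow]
      exact Function.iterate_fixed hw n
    · rintro ⟨x, hx, rfl⟩
      change delete p (φ x) = x at hx
      change φ ((f ^ n) x) = (f ^ n) x
      rw [← hcomm, ← hdel, hx]
  rw [hmap]
  exact hfg.map _
end

section
/- Let (A,I) be a finite independence alphabet. Then for every endomorphism φ of the trace monoid M(A,I), the set Per φ of periodic points of φ is a finitely generated submonoid of M(A,I). -/
/-- The length homomorphism of the trace monoid. -/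
def traceLength (A : Type) (I : A → A → Prop) : TraceMonoid A I →* Multiplicative ℕ :=
  (traceCon A I).lift (FreeMonoid.lift fun _ => Multiplicative.ofAdd 1) <| by
    refine Con.conGen_le.2 ?_
    rintro x y ⟨a, b, -, rfl, rfl⟩
    simp [Con.ker_rel]

/-- The trace of a single letter. -/
def traceLetter {A : Type} (I : A → A → Prop) (a : A) : TraceMonoid A I :=
  (FreeMonoid.of a : FreeMonoid A)

theorem traceLength_coe {A : Type} {I : A → A → Prop} (w : FreeMonoid A) :
    (traceLength A I (w : TraceMonoid A I)).toAdd = w.length := by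
  induction w using FreeMonoid.inductionOn' with
  | one => simp
  | of_mul a w ih =>
    rw [Con.coe_mul, map_mul, toAdd_mul, ih, FreeMonoid.length_mul]
    congr 1

theorem finite_traceLength_le {A : Type} [Finite A] (I : A → A → Prop) (L : ℕ) :
    {x : TraceMonoid A I | (traceLength A I x).toAdd ≤ L}.Finite := by
  refine ((List.finite_length_le A L).image
    fun l => ((FreeMonoid.ofList l : FreeMonoid A) : TraceMonoid A I)).subset fun x hx => ?_
  induction x using Con.induction_on with
  | H w => exact ⟨w.toList, (traceLength_coe w).symm.trans_le hx, rfl⟩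

/-- A point with finite orbit is sent to a fixed point of `f^[N]` by `f^[N]`, for every positive
multiple `N` of a suitable number. -/
theorem exists_iterate_iterate_eq_of_finite_orbit {α : Type*} (f : α → α) (a : α)
    (h : (Set.range fun k => f^[k] a).Finite) :
    ∃ M : ℕ, 1 ≤ M ∧ ∀ N, 1 ≤ N → M ∣ N → f^[N] (f^[N] a) = f^[N] a := by
  obtain ⟨i, j, hij, he⟩ : ∃ i j : ℕ, i < j ∧ f^[i] a = f^[j] a := by
    have : ¬ Function.Injective fun k => f^[k] a := fun hi =>
      Set.infinite_range_of_injective hi h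
    simp only [Function.Injective, not_forall] at this
    obtain ⟨i, j, he, hne⟩ := this
    rcases lt_or_gt_of_ne hne with hlt | hlt
    · exact ⟨i, j, hlt, he⟩
    · exact ⟨j, i, hlt, he.symm⟩
  have hp : Function.IsPeriodicPt f (j - i) (f^[i] a) := by
    rw [Function.IsPeriodicPt, Function.IsFixedPt, ← Function.iterate_add_apply,
      Nat.sub_add_cancel hij.le, he]
  have hpos : 1 ≤ j - i := by omega
  refine ⟨(i + 1) * (j - i), Nat.mul_pos i.succ_pos hpos, fun N hN hd => ?_⟩
  have hle : i ≤ N := by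
    have h1 := Nat.le_of_dvd hN hd
    have h2 := Nat.le_mul_of_pos_right (i + 1) hpos
    omega
  have h3 := (hp.apply_iterate (N - i)).trans_dvd ((Nat.dvd_mul_left _ _).trans hd)
  rwa [← Function.iterate_add_apply, Nat.sub_add_cancel hle] at h3

theorem exists_pow_idempotent_on_finite_orbits {A : Type} [Fintype A] {M : Type*} [Monoid M]
    (g : A → M) (φ : Monoid.End M) :
    ∃ N : ℕ, 1 ≤ N ∧ ∀ a, (Set.range fun k => φ^[k] (g a)).Finite →
      (φ ^ N) ((φ ^ N) (g a)) = (φ ^ N) (g a) := by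
  have key : ∀ a, ∃ m : ℕ, 1 ≤ m ∧ ((Set.range fun k => φ^[k] (g a)).Finite →
      ∀ N, 1 ≤ N → m ∣ N → φ^[N] (φ^[N] (g a)) = φ^[N] (g a)) := fun a => by
    by_cases h : (Set.range fun k => φ^[k] (g a)).Finite
    · obtain ⟨m, hm, hN⟩ := exists_iterate_iterate_eq_of_finite_orbit φ (g a) h
      exact ⟨m, hm, fun _ => hN⟩
    · exact ⟨1, le_rfl, fun h' => absurd h' h⟩
  choose m hm hN using key
  have hpos : 1 ≤ ∏ a, m a := Nat.one_le_iff_ne_zero.2 <|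
    Finset.prod_ne_zero_iff.2 fun a _ => Nat.one_le_iff_ne_zero.1 (hm a)
  refine ⟨∏ a, m a, hpos, fun a ha => ?_⟩
  simpa [Monoid.End.coe_pow] using
    hN a ha _ hpos (Finset.dvd_prod_of_mem m (Finset.mem_univ a))

/-- If the orbit of a trace has bounded length, then its image under `φ ^ N` is a product of those
images of letters having finite orbit. -/
theorem pow_mem_closure_of_bounded_orbit {A : Type} [Finite A] {I : A → A → Prop}
    (φ : Monoid.End (TraceMonoid A I)) (N L : ℕ) (w : FreeMonoid A)
    (hw : ∀ k, (traceLength A I (φ^[k] (w : TraceMonoid A I))).toAdd ≤ L) :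
    (φ ^ N) (w : TraceMonoid A I) ∈ Submonoid.closure ((fun a => (φ ^ N) (traceLetter I a)) ''
      {a | (Set.range fun k => φ^[k] (traceLetter I a)).Finite}) := by
  induction w using FreeMonoid.inductionOn' with
  | one => rw [Con.coe_one, map_one]; exact one_mem _
  | of_mul a w ih =>
    have hsplit : ∀ k, (traceLength A I (φ^[k] (traceLetter I a))).toAdd +
        (traceLength A I (φ^[k] (w : TraceMonoid A I))).toAdd ≤ L := fun k => by
      simpa [iterate_map_mul, traceLetter] using hw k
    rw [Con.coe_mul, map_mul]
    refine mul_mem (Submonoid.subset_closure ⟨a, ?_, rfl⟩)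
      (ih fun k => (Nat.le_add_left _ _).trans (hsplit k))
    refine (finite_traceLength_le I L).subset ?_
    rintro _ ⟨k, rfl⟩
    exact (Nat.le_add_right _ _).trans (hsplit k)

/-- For a finite independence alphabet `(A,I)`, the set of periodic points of any
endomorphism of the trace monoid `M(A,I)` is a finitely generated submonoid. -/
theorem per_fg (A : Type) [Fintype A] (I : A → A → Prop)
    (hsym : Symmetric I) (hirr : Irreflexive I)
    (φ : Monoid.End (TraceMonoid A I)) :
    ∃ S : Submonoid (TraceMonoid A I),
      (S : Set (TraceMonoid A I)) = {x | ∃ n : ℕ, 1 ≤ n ∧ (φ ^ n) x = x} ∧ S.FG := by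
  obtain ⟨N, hN, hfix⟩ := exists_pow_idempotent_on_finite_orbits (traceLetter I) φ
  set T := (fun a => (φ ^ N) (traceLetter I a)) ''
      {a | (Set.range fun k => φ^[k] (traceLetter I a)).Finite}
  have hS : Submonoid.closure T ≤ MonoidHom.eqLocusM (φ ^ N) (MonoidHom.id _) := by
    refine Submonoid.closure_le.2 ?_
    rintro _ ⟨a, ha, rfl⟩
    exact hfix a ha
  refine ⟨Submonoid.closure T, Set.Subset.antisymm (fun x hx => ⟨N, hN, hS hx⟩) ?_,
    (Submonoid.fg_iff _).2 ⟨T, rfl, (Set.toFinite _).image _⟩⟩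
  rintro x ⟨n, hn, hx⟩
  have hper : Function.IsPeriodicPt φ n x := by rwa [Monoid.End.coe_pow] at hx
  obtain ⟨L, hL⟩ : ∃ L, ∀ k, (traceLength A I (φ^[k] x)).toAdd ≤ L := by
    refine ⟨(Finset.range n).sup fun k => (traceLength A I (φ^[k] x)).toAdd, fun k => ?_⟩
    rw [← hper.iterate_mod_apply k]
    exact Finset.le_sup (f := fun k => (traceLength A I (φ^[k] x)).toAdd)
      (Finset.mem_range.2 (Nat.mod_lt k hn))
  have hmem : (φ ^ N) x ∈ Submonoid.closure T := by
    induction x using Con.induction_on with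
    | H w => exact pow_mem_closure_of_bounded_orbit φ N L w hL
  have hNfix : Function.IsFixedPt φ^[N] (φ^[N] x) := by
    have h : (φ ^ N) ((φ ^ N) x) = (φ ^ N) x := hS hmem
    rwa [Monoid.End.coe_pow] at h
  have hx' : φ^[N] x = x := by
    have h1 : (φ^[N])^[n] x = x := by
      rw [← Function.iterate_mul, mul_comm, Function.iterate_mul]
      exact Function.IsFixedPt.iterate hper N
    obtain ⟨m, rfl⟩ : ∃ m, n = m + 1 := ⟨n - 1, by omega⟩
    rw [Function.iterate_succ_apply] at h1
    exact (hNfix.iterate m).symm.trans h1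
  rwa [Monoid.End.coe_pow, hx'] at hmem
end

section
/- Let (A,I) be a finite independence alphabet, let M(A,I) be the trace monoid equipped with the Foata normal form metric d, and let φ be an endomorphism of M(A,I). Then the following are equivalent: (i) φ is uniformly continuous with respect to d; (ii) φ is a contraction with respect to d, i.e., d(φ(u),φ(v)) ≤ d(u,v) for all u,v; (iii) for all letters a,b,c ∈ A, if c is a prefix of φ(b) and c ∼_I φ(a), then (a,b) ∈ I. -/
/-- The image in the trace monoid of a letter `a ∈ A`. -/
def traceOf (A : Type) (I : A → A → Prop) (a : A) : TraceMonoid A I :=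
  (traceCon A I).mk' (FreeMonoid.of a)

/-- The set of letters which are periodic points of the endomorphism `φ`. -/
def perLetters (A : Type) (I : A → A → Prop) (φ : Monoid.End (TraceMonoid A I)) : Set A :=
  {a : A | ∃ n : ℕ, 1 ≤ n ∧ (φ ^ n) (traceOf A I a) = traceOf A I a}

/-- A clique of the independence graph: a nonempty set of letters that pairwise
commute (are pairwise independent). -/
def IsClique (A : Type) (I : A → A → Prop) (B : Finset A) : Prop :=
  B.Nonempty ∧ ∀ a ∈ B, ∀ b ∈ B, a ≠ b → I a b

/-- `w_B`: the product in the trace monoid of all letters of `B`. -/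
noncomputable def wB (A : Type) (I : A → A → Prop) (B : Finset A) : TraceMonoid A I :=
  (B.toList.map (traceOf A I)).prod

/-- The product `w_{B₁} ⋯ w_{B_k}` associated with a list of cliques. -/
noncomputable def wProd (A : Type) (I : A → A → Prop) (L : List (Finset A)) :
    TraceMonoid A I :=
  (L.map (wB A I)).prod

/-- A list `[B₁, …, B_k]` is a Foata chain if each `B_i` is a clique and, for every
`i ≥ 2` and every `a ∈ B_i`, there is some `b ∈ B_{i-1}` with `(a,b) ∉ I`. -/
def IsFoataChain (A : Type) (I : A → A → Prop) (L : List (Finset A)) : Prop :=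
  (∀ B ∈ L, IsClique A I B) ∧
    ∀ i : ℕ, (hi : i + 1 < L.length) →
      ∀ a ∈ L[i + 1], ∃ b ∈ L[i], ¬ I a b

/-- `[B₁, …, B_k]` is the Foata normal form of `u` if it is a Foata chain whose
product is `u`. (Such a list exists and is unique for every `u`.) -/
def IsFNF (A : Type) (I : A → A → Prop) (L : List (Finset A)) (u : TraceMonoid A I) :
    Prop :=
  IsFoataChain A I L ∧ u = wProd A I L

/-- For `u ≠ v`, `rNat u v` is the largest `k` such that the Foata normal forms of
`u` and `v` have the same first `k` components. -/
noncomputable def rNat (A : Type) (I : A → A → Prop) (u v : TraceMonoid A I) : ℕ :=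
  sSup {k : ℕ | ∃ P Lu Lv : List (Finset A), P.length = k ∧
    IsFNF A I (P ++ Lu) u ∧ IsFNF A I (P ++ Lv) v}

open Classical

/-- `r(u,v) ∈ ℕ ∪ {∞}`: the length of the longest common prefix of the Foata normal
forms of `u` and `v`, with `r(u,u) = ∞`. -/
noncomputable def rE (A : Type) (I : A → A → Prop) (u v : TraceMonoid A I) : ℕ∞ :=
  if u = v then ⊤ else (rNat A I u v : ℕ∞)

/-- The Foata normal form metric: `d(u,v) = 2^{-r(u,v)}`, with `2^{-∞} = 0`. -/
noncomputable def dFNF (A : Type) (I : A → A → Prop) (u v : TraceMonoid A I) : ℝ :=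
  if u = v then 0 else (2 : ℝ) ^ (-(rNat A I u v : ℤ))

/-- The content of a trace: the set of letters occurring in (any representative of) it. -/
def content (A : Type) (I : A → A → Prop) (u : TraceMonoid A I) : Set A :=
  {a : A | ∃ w : FreeMonoid A, (traceCon A I).mk' w = u ∧ a ∈ FreeMonoid.toList w}

/-- A state of the scan of a word from left to right: for each letter `a`, the length of the
longest dependent chain read so far that ends in a letter dependent on `a`; and for each `j`,
the set of letters read so far at height `j + 1`. -/
abbrev FoataState (A : Type) := (A → ℕ) × (ℕ → Finset A)

/-- The effect of reading one letter. -/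
noncomputable def foataStep {A : Type} (I : A → A → Prop) (s : FoataState A) (b : A) :
    FoataState A :=
  (fun a => if I a b then s.1 a else max (s.1 a) (s.1 b + 1),
    fun j => if j = s.1 b then insert b (s.2 j) else s.2 j)

theorem foataStep_comm {A : Type} {I : A → A → Prop} (hsym : Symmetric I) (s : FoataState A)
    {a b : A} (hab : I a b) :
    foataStep I (foataStep I s a) b = foataStep I (foataStep I s b) a := by
  have hba := hsym hab
  refine Prod.ext ?_ ?_
  · funext x
    simp only [foataStep, hab, hba, if_true]
    split_ifs <;> omega
  · funext j
    simp only [foataStep, hab, hba, if_true]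
    split_ifs <;> simp [Finset.insert_comm]

/-- Reading words, as a homomorphism from the free monoid. -/
noncomputable def foataFree {A : Type} (I : A → A → Prop) :
    FreeMonoid A →* (Function.End (FoataState A))ᵐᵒᵖ :=
  FreeMonoid.lift fun b => MulOpposite.op fun s => foataStep I s b

theorem traceCon_le_ker_foataFree {A : Type} {I : A → A → Prop} (hsym : Symmetric I) :
    traceCon A I ≤ Con.ker (foataFree I) := by
  refine Con.conGen_le.2 ?_
  rintro x y ⟨a, b, hab, rfl, rfl⟩
  refine MulOpposite.unop_injective ?_
  funext s
  simp only [foataFree, map_mul, FreeMonoid.lift_eval_of, MulOpposite.unop_mul]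
  exact foataStep_comm hsym s hab

/-- The action of a trace on states. -/
noncomputable def foataAct {A : Type} {I : A → A → Prop} (hsym : Symmetric I)
    (u : TraceMonoid A I) : FoataState A → FoataState A :=
  (Con.lift (traceCon A I) (foataFree I) (traceCon_le_ker_foataFree hsym) u).unop

theorem foataAct_one {A : Type} {I : A → A → Prop} (hsym : Symmetric I) (s : FoataState A) :
    foataAct hsym 1 s = s := by
  simp only [foataAct, map_one, MulOpposite.unop_one]
  rfl

theorem foataAct_mul {A : Type} {I : A → A → Prop} (hsym : Symmetric I) (u v : TraceMonoid A I)
    (s : FoataState A) : foataAct hsym (u * v) s = foataAct hsym v (foataAct hsym u s) := by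
  simp only [foataAct, map_mul, MulOpposite.unop_mul]
  rfl

theorem foataAct_traceOf {A : Type} {I : A → A → Prop} (hsym : Symmetric I) (b : A)
    (s : FoataState A) : foataAct hsym (traceOf A I b) s = foataStep I s b := by
  simp only [foataAct, traceOf, Con.lift_mk', foataFree, FreeMonoid.lift_eval_of]
  rfl

theorem exists_word {A : Type} {I : A → A → Prop} (u : TraceMonoid A I) :
    ∃ l : List A, (l.map (traceOf A I)).prod = u := by
  obtain ⟨w, rfl⟩ := Con.mk'_surjective (c := traceCon A I) u
  induction w using FreeMonoid.inductionOn' with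
  | one => exact ⟨[], by simp⟩
  | of_mul x w ih =>
    obtain ⟨l, hl⟩ := ih
    exact ⟨x :: l, by simp [hl, traceOf]⟩

theorem mk'_ofList {A : Type} {I : A → A → Prop} (l : List A) :
    (traceCon A I).mk' (FreeMonoid.ofList l) = (l.map (traceOf A I)).prod := by
  induction l with
  | nil => simp
  | cons x l ih => rw [FreeMonoid.ofList_cons, map_mul, ih]; simp [traceOf]

theorem mem_content_of_mem {A : Type} {I : A → A → Prop} {l : List A} {a : A} (ha : a ∈ l) :
    a ∈ content A I (l.map (traceOf A I)).prod :=
  ⟨FreeMonoid.ofList l, mk'_ofList l, by simpa using ha⟩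

theorem foataAct_append_letter {A : Type} {I : A → A → Prop} (hsym : Symmetric I) (l : List A)
    (b : A) (s : FoataState A) :
    foataAct hsym ((l ++ [b]).map (traceOf A I)).prod s =
      foataStep I (foataAct hsym (l.map (traceOf A I)).prod s) b := by
  simp [foataAct_mul, foataAct_traceOf]

theorem foataAct_cons_letter {A : Type} {I : A → A → Prop} (hsym : Symmetric I) (l : List A)
    (b : A) (s : FoataState A) :
    foataAct hsym ((b :: l).map (traceOf A I)).prod s =
      foataAct hsym (l.map (traceOf A I)).prod (foataStep I s b) := by
  simp [foataAct_mul, foataAct_traceOf]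

theorem foataStep_mono {A : Type} {I : A → A → Prop} (b a : A) (s : FoataState A) :
    s.1 a ≤ (foataStep I s b).1 a := by
  simp only [foataStep]
  split_ifs <;> omega

theorem foataStep_fst_of_dep {A : Type} {I : A → A → Prop} {a b : A} (h : ¬ I a b)
    (s : FoataState A) : s.1 b + 1 ≤ (foataStep I s b).1 a := by
  simp [foataStep, h]

theorem foataStep_snd_mono {A : Type} {I : A → A → Prop} (b : A) (j : ℕ) (s : FoataState A) :
    s.2 j ⊆ (foataStep I s b).2 j := by
  simp only [foataStep]
  split_ifs
  · exact Finset.subset_insert _ _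
  · exact subset_rfl

theorem foataAct_mono {A : Type} {I : A → A → Prop} (hsym : Symmetric I) (u : TraceMonoid A I)
    (a : A) (s : FoataState A) : s.1 a ≤ (foataAct hsym u s).1 a := by
  obtain ⟨l, rfl⟩ := exists_word u
  induction l using List.reverseRecOn with
  | nil => simp [foataAct_one]
  | append_singleton l b ih =>
    rw [foataAct_append_letter]
    exact ih.trans (foataStep_mono _ _ _)

theorem foataAct_snd_mono {A : Type} {I : A → A → Prop} (hsym : Symmetric I)
    (u : TraceMonoid A I) (j : ℕ) (s : FoataState A) : s.2 j ⊆ (foataAct hsym u s).2 j := by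
  obtain ⟨l, rfl⟩ := exists_word u
  induction l using List.reverseRecOn with
  | nil => simp [foataAct_one]
  | append_singleton l b ih =>
    rw [foataAct_append_letter]
    exact ih.trans (foataStep_snd_mono _ _ _)

theorem foataAct_snd_subset {A : Type} {I : A → A → Prop} (hsym : Symmetric I) (l : List A)
    (j : ℕ) (s : FoataState A) :
    (foataAct hsym (l.map (traceOf A I)).prod s).2 j ⊆ s.2 j ∪ l.toFinset := by
  induction l using List.reverseRecOn with
  | nil => simp [foataAct_one]
  | append_singleton l b ih =>
    rw [foataAct_append_letter]
    intro x hx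
    have key : x = b ∨ x ∈ (foataAct hsym (l.map (traceOf A I)).prod s).2 j := by
      simp only [foataStep] at hx
      split_ifs at hx
      · simpa using hx
      · exact Or.inr hx
    rcases key with rfl | h
    · simp
    · have := ih h
      simp only [Finset.mem_union, List.mem_toFinset, List.mem_append] at this ⊢
      tauto

theorem traceOf_comm {A : Type} {I : A → A → Prop} {a b : A} (h : I a b) :
    traceOf A I a * traceOf A I b = traceOf A I b * traceOf A I a := by
  simp only [traceOf, ← map_mul]
  exact (Con.eq _).2 (ConGen.Rel.of _ _ ⟨a, b, h, rfl, rfl⟩)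

theorem commute_prod {A : Type} {I : A → A → Prop} {c : A} {l : List A} (h : ∀ x ∈ l, I c x) :
    Commute (traceOf A I c) (l.map (traceOf A I)).prod := by
  refine Commute.list_prod_right _ _ ?_
  intro y hy
  obtain ⟨x, hx, rfl⟩ := List.mem_map.1 hy
  exact traceOf_comm (h x hx)

/-- If all letters that can be moved to the front of a word have height greater than `m`,
then so have all letters of the word. -/
theorem foataAct_of_le_initial {A : Type} {I : A → A → Prop} (hsym : Symmetric I)
    (s : FoataState A) (m : ℕ) (l : List A)
    (hm : ∀ c w, (l.map (traceOf A I)).prod = traceOf A I c * w → m ≤ s.1 c) :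
    (∀ c, (∃ x ∈ l, ¬ I c x) → m + 1 ≤ (foataAct hsym (l.map (traceOf A I)).prod s).1 c) ∧
      ∀ j < m, (foataAct hsym (l.map (traceOf A I)).prod s).2 j = s.2 j := by
  induction l using List.reverseRecOn with
  | nil => simp [foataAct_one]
  | append_singleton l b ih =>
    obtain ⟨ih1, ih2⟩ := ih fun c w h => hm c (w * traceOf A I b) (by simp [h, mul_assoc])
    rw [foataAct_append_letter]
    have hb : m ≤ (foataAct hsym (l.map (traceOf A I)).prod s).1 b := by
      by_cases hI : ∀ x ∈ l, I b x
      · refine (hm b (l.map (traceOf A I)).prod ?_).trans (foataAct_mono hsym _ _ _)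
        simpa using (commute_prod hI).eq.symm
      · push Not at hI
        have := ih1 b hI
        omega
    refine ⟨?_, ?_⟩
    · rintro c ⟨x, hx, hcx⟩
      rcases List.mem_append.1 hx with hx | hx
      · exact (ih1 c ⟨x, hx, hcx⟩).trans (foataStep_mono _ _ _)
      · obtain rfl : x = b := by simpa using hx
        exact (Nat.succ_le_succ hb).trans (foataStep_fst_of_dep hcx _)
    · intro j hj
      rw [← ih2 j hj]
      simp only [foataStep]
      rw [if_neg (by omega)]

/-- `foataHeight hsym u a + 1` is the height of the last letter of `u * a`. -/
noncomputable def foataHeight {A : Type} {I : A → A → Prop} (hsym : Symmetric I)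
    (u : TraceMonoid A I) (a : A) : ℕ :=
  (foataAct hsym u (fun _ => 0, fun _ => ∅)).1 a

/-- The `j`-th Foata layer of a trace, counted from `0`. -/
noncomputable def foataLayer {A : Type} {I : A → A → Prop} (hsym : Symmetric I)
    (u : TraceMonoid A I) (j : ℕ) : Finset A :=
  (foataAct hsym u (fun _ => 0, fun _ => ∅)).2 j

theorem foataHeight_mul_le {A : Type} {I : A → A → Prop} (hsym : Symmetric I)
    (u v : TraceMonoid A I) (a : A) : foataHeight hsym u a ≤ foataHeight hsym (u * v) a := by
  rw [foataHeight, foataHeight, foataAct_mul]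
  exact foataAct_mono _ _ _ _

theorem foataLayer_mul_of_le_height {A : Type} {I : A → A → Prop} (hsym : Symmetric I)
    (u v : TraceMonoid A I) (m : ℕ) (hm : ∀ c w, v = traceOf A I c * w → m ≤ foataHeight hsym u c)
    {j : ℕ} (hj : j < m) : foataLayer hsym (u * v) j = foataLayer hsym u j := by
  obtain ⟨l, rfl⟩ := exists_word v
  rw [foataLayer, foataAct_mul]
  exact (foataAct_of_le_initial hsym _ m l hm).2 j hj

theorem foataLayer_mul_traceOf {A : Type} {I : A → A → Prop} (hsym : Symmetric I)
    (u : TraceMonoid A I) (b : A) {j : ℕ} (hj : j < foataHeight hsym u b) :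
    foataLayer hsym (u * traceOf A I b) j = foataLayer hsym u j := by
  rw [foataLayer, foataAct_mul, foataAct_traceOf]
  exact if_neg (Nat.ne_of_lt hj)

theorem foataHeight_mul_traceOf_of_dep {A : Type} {I : A → A → Prop} (hsym : Symmetric I)
    (u : TraceMonoid A I) {a b : A} (h : ¬ I a b) :
    foataHeight hsym u b + 1 ≤ foataHeight hsym (u * traceOf A I b) a := by
  rw [foataHeight, foataHeight, foataAct_mul, foataAct_traceOf]
  exact foataStep_fst_of_dep h _

theorem le_foataHeight_pow {A : Type} {I : A → A → Prop} (hsym : Symmetric I)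
    (hirr : Irreflexive I) {a b : A} (h : ¬ I b a) (n : ℕ) :
    n ≤ foataHeight hsym (traceOf A I a ^ n) b := by
  induction n generalizing b with
  | zero => exact Nat.zero_le _
  | succ n ih =>
    rw [pow_succ]
    exact (Nat.succ_le_succ (ih (hirr a))).trans (foataHeight_mul_traceOf_of_dep hsym _ h)

theorem mem_foataLayer_zero {A : Type} {I : A → A → Prop} (hsym : Symmetric I) (c : A)
    (w : TraceMonoid A I) : c ∈ foataLayer hsym (traceOf A I c * w) 0 := by
  rw [foataLayer, foataAct_mul, foataAct_traceOf]
  refine foataAct_snd_mono hsym w 0 _ ?_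
  simp [foataStep]

theorem foataLayer_prod_subset {A : Type} {I : A → A → Prop} (hsym : Symmetric I) (l : List A)
    (j : ℕ) : foataLayer hsym (l.map (traceOf A I)).prod j ⊆ l.toFinset := by
  simpa [foataLayer] using foataAct_snd_subset hsym l j (fun _ => 0, fun _ => ∅)

theorem foataAct_clique {A : Type} {I : A → A → Prop} (hsym : Symmetric I) (n : ℕ) (l : List A)
    (hl : l.Pairwise I) (s : FoataState A) (hs : ∀ a, s.1 a ≤ n + 1) (hn : ∀ a ∈ l, s.1 a = n) :
    (∀ a, (foataAct hsym (l.map (traceOf A I)).prod s).1 a =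
        if ∃ b ∈ l, ¬ I a b then n + 1 else s.1 a) ∧
      ∀ j, (foataAct hsym (l.map (traceOf A I)).prod s).2 j =
        if j = n then l.toFinset ∪ s.2 j else s.2 j := by
  induction l generalizing s with
  | nil => simp [foataAct_one]
  | cons b l ih =>
    have hb : s.1 b = n := hn b (by simp)
    have hl' := List.pairwise_cons.1 hl
    have h1 : ∀ a, (foataStep I s b).1 a = if I a b then s.1 a else n + 1 := by
      intro a
      have := hs a
      simp only [foataStep, hb]
      split_ifs <;> omega
    rw [foataAct_cons_letter]
    obtain ⟨ih1, ih2⟩ := ih hl'.2 (foataStep I s b)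
      (by intro a; have := hs a; rw [h1]; split_ifs <;> omega)
      (by
        intro a ha
        rw [h1, if_pos (hsym (hl'.1 a ha))]
        exact hn a (by simp [ha]))
    refine ⟨fun a => ?_, fun j => ?_⟩
    · rw [ih1, h1]
      by_cases hab : I a b <;> simp [hab]
    · rw [ih2]
      simp only [foataStep, hb]
      split_ifs <;> simp

theorem isFoataChain_iff {A : Type} {I : A → A → Prop} (L : List (Finset A)) :
    IsFoataChain A I L ↔ (∀ B ∈ L, IsClique A I B) ∧
      L.IsChain fun B C => ∀ a ∈ C, ∃ b ∈ B, ¬ I a b := by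
  rw [IsFoataChain, List.isChain_iff_getElem]

theorem IsFoataChain.of_append {A : Type} {I : A → A → Prop} {L M : List (Finset A)}
    (h : IsFoataChain A I (L ++ M)) : IsFoataChain A I L := by
  rw [isFoataChain_iff] at h ⊢
  exact ⟨fun B hB => h.1 B (by simp [hB]), (List.isChain_append.1 h.2).1⟩

theorem wProd_append {A : Type} {I : A → A → Prop} (L M : List (Finset A)) :
    wProd A I (L ++ M) = wProd A I L * wProd A I M := by
  simp [wProd]

theorem IsClique.pairwise_toList {A : Type} {I : A → A → Prop} {B : Finset A}
    (h : IsClique A I B) : B.toList.Pairwise I := by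
  refine (List.Nodup.pairwise_of_forall_ne B.nodup_toList ?_)
  intro a ha b hb hab
  exact h.2 a (by simpa using ha) b (by simpa using hb) hab

theorem foataAct_wProd {A : Type} {I : A → A → Prop} (hsym : Symmetric I) (L : List (Finset A))
    (hL : IsFoataChain A I L) :
    (∀ a, foataHeight hsym (wProd A I L) a ≤ L.length) ∧
      (∀ B ∈ L.getLast?, ∀ a, (∃ b ∈ B, ¬ I a b) →
        foataHeight hsym (wProd A I L) a = L.length) ∧
      ∀ j, foataLayer hsym (wProd A I L) j = (L[j]?).getD ∅ := by
  induction L using List.reverseRecOn with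
  | nil => simp [wProd, foataAct_one, foataHeight, foataLayer]
  | append_singleton L B ih =>
    obtain ⟨ih1, ih2, ih3⟩ := ih hL.of_append
    have hL' := (isFoataChain_iff _).1 hL
    have hB : IsClique A I B := hL'.1 B (by simp)
    have hB' : ∀ a ∈ B, foataHeight hsym (wProd A I L) a = L.length := by
      intro a ha
      rcases List.eq_nil_or_concat L with rfl | ⟨L', C, rfl⟩
      · have := ih1 a
        simpa using this
      · refine ih2 C (by simp) a ?_
        exact (List.isChain_append.1 hL'.2).2.2 C (by simp) B (by simp) a ha
    obtain ⟨h1, h2⟩ := foataAct_clique hsym L.length B.toList hB.pairwise_toList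
      (foataAct hsym (wProd A I L) (fun _ => 0, fun _ => ∅))
      (fun a => (ih1 a).trans (Nat.le_succ _)) (fun a ha => hB' a (by simpa using ha))
    have hw : wProd A I (L ++ [B]) = wProd A I L * (B.toList.map (traceOf A I)).prod := by
      rw [wProd_append]; simp [wProd, wB]
    refine ⟨?_, ?_, ?_⟩
    · intro a
      rw [foataHeight, hw, foataAct_mul, h1]
      have := ih1 a
      rw [foataHeight] at this
      simp only [List.length_append, List.length_singleton]
      split_ifs <;> omega
    · intro C hC a ha
      obtain rfl : B = C := by simpa using hC
      rw [foataHeight, hw, foataAct_mul, h1, if_pos (by simpa using ha)]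
      simp
    · intro j
      rw [foataLayer, hw, foataAct_mul, h2]
      have := ih3 j
      rw [foataLayer] at this
      rw [this]
      split_ifs with hj
      · simp [hj]
      · rcases Nat.lt_or_ge j L.length with h | h
        · rw [List.getElem?_append_left h]
        · rw [List.getElem?_eq_none h, List.getElem?_eq_none (by simp; omega)]

theorem height_eq_length {A : Type} {I : A → A → Prop} (hsym : Symmetric I)
    {L : List (Finset A)} {B : Finset A} (hL : IsFoataChain A I (L ++ [B])) {a : A} (ha : a ∈ B) :
    foataHeight hsym (wProd A I L) a = L.length := by
  obtain ⟨h1, h2, -⟩ := foataAct_wProd hsym L hL.of_append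
  rcases List.eq_nil_or_concat L with rfl | ⟨L', C, rfl⟩
  · have := h1 a
    simpa using this
  · refine h2 C (by simp) a ?_
    exact (List.isChain_append.1 ((isFoataChain_iff _).1 hL).2).2.2 C (by simp) B (by simp) a ha

theorem exists_split_last_dep {A : Type} (I : A → A → Prop) (L : List (Finset A)) (b : A) :
    ∃ L₁ L₂, L = L₁ ++ L₂ ∧ (∀ B ∈ L₂, ∀ x ∈ B, I b x) ∧
      ∀ B ∈ L₁.getLast?, ∃ x ∈ B, ¬ I b x := by
  induction L using List.reverseRecOn with
  | nil => exact ⟨[], [], by simp⟩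
  | append_singleton L B ih =>
    by_cases h : ∃ x ∈ B, ¬ I b x
    · exact ⟨L ++ [B], [], by simp, by simp, by simpa using h⟩
    · obtain ⟨L₁, L₂, rfl, h₁, h₂⟩ := ih
      push Not at h
      refine ⟨L₁, L₂ ++ [B], by simp, ?_, h₂⟩
      intro C hC
      rcases List.mem_append.1 hC with hC | hC
      · exact h₁ C hC
      · obtain rfl : C = B := by simpa using hC
        exact h

theorem commute_wB {A : Type} {I : A → A → Prop} {b : A} {B : Finset A}
    (h : ∀ x ∈ B, I b x) : Commute (traceOf A I b) (wB A I B) :=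
  commute_prod fun x hx => h x (by simpa using hx)

theorem commute_wProd {A : Type} {I : A → A → Prop} {b : A} {L : List (Finset A)}
    (h : ∀ B ∈ L, ∀ x ∈ B, I b x) : Commute (traceOf A I b) (wProd A I L) := by
  refine Commute.list_prod_right _ _ ?_
  intro y hy
  obtain ⟨B, hB, rfl⟩ := List.mem_map.1 hy
  exact commute_wB (h B hB)

theorem wB_insert {A : Type} {I : A → A → Prop} {b : A} {B : Finset A}
    (hB : IsClique A I (insert b B)) (hb : b ∉ B) :
    wB A I (insert b B) = traceOf A I b * wB A I B := by
  have hperm : (insert b B).toList.Perm (b :: B.toList) := Finset.toList_insert hb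
  have := (hperm.map (traceOf A I)).prod_eq' (List.pairwise_map.2
    (hB.pairwise_toList.imp fun h => traceOf_comm h))
  rw [wB, this]
  simp [wB]

theorem exists_isFNF {A : Type} {I : A → A → Prop} (hsym : Symmetric I) (hirr : Irreflexive I)
    (u : TraceMonoid A I) : ∃ L, IsFNF A I L u := by
  obtain ⟨l, rfl⟩ := exists_word u
  induction l using List.reverseRecOn with
  | nil => exact ⟨[], by simp [IsFoataChain], by simp [wProd]⟩
  | append_singleton l b ih =>
    obtain ⟨L, hL, hw⟩ := ih
    rw [List.map_append, List.prod_append, hw]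
    obtain ⟨L₁, L₂, rfl, h₁, h₂⟩ := exists_split_last_dep I L b
    obtain ⟨hc, hch⟩ := (isFoataChain_iff _).1 hL
    obtain ⟨hch₁, hch₂, hch₃⟩ := List.isChain_append.1 hch
    cases L₂ with
    | nil =>
      refine ⟨L₁ ++ [{b}], (isFoataChain_iff _).2 ⟨?_, ?_⟩, ?_⟩
      · intro B hB
        rcases List.mem_append.1 hB with hB | hB
        · exact hc B (by simp [hB])
        · obtain rfl : B = {b} := by simpa using hB
          exact ⟨by simp, by simp⟩
      · refine List.isChain_append.2 ⟨hch₁, by simp, ?_⟩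
        intro B hB C hC
        obtain rfl : {b} = C := by simpa using hC
        simpa using h₂ B hB
      · rw [List.append_nil, wProd_append]
        simp [wProd, wB]
    | cons B L₃ =>
      have hbB : ∀ x ∈ B, I b x := h₁ B (by simp)
      have hb : b ∉ B := fun h => hirr b (hbB b h)
      have hB : IsClique A I B := hc B (by simp)
      have hins : IsClique A I (insert b B) := by
        refine ⟨by simp, ?_⟩
        intro x hx y hy hxy
        rcases Finset.mem_insert.1 hx with rfl | hxB <;>
          rcases Finset.mem_insert.1 hy with rfl | hyB
        · exact absurd rfl hxy
        · exact hbB y hyB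
        · exact hsym (hbB x hxB)
        · exact hB.2 x hxB y hyB hxy
      refine ⟨L₁ ++ insert b B :: L₃, (isFoataChain_iff _).2 ⟨?_, ?_⟩, ?_⟩
      · intro C hC
        rcases List.mem_append.1 hC with hC | hC
        · exact hc C (by simp [hC])
        · rcases List.mem_cons.1 hC with rfl | hC
          · exact hins
          · exact hc C (by simp [hC])
      · rw [List.isChain_cons] at hch₂
        refine List.isChain_append.2 ⟨hch₁, List.isChain_cons.2 ⟨?_, hch₂.2⟩, ?_⟩
        · intro C hC a ha
          obtain ⟨x, hx, hax⟩ := hch₂.1 C hC a ha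
          exact ⟨x, Finset.mem_insert_of_mem hx, hax⟩
        · intro C hC D hD
          obtain rfl : insert b B = D := by simpa using hD
          intro a ha
          rcases Finset.mem_insert.1 ha with rfl | ha
          · exact h₂ C hC
          · exact hch₃ C hC B (by simp) a ha
      · have e : ∀ C, wProd A I (C :: L₃) = wB A I C * wProd A I L₃ := fun C => by simp [wProd]
        have hcomm := (commute_wProd h₁).eq
        rw [e] at hcomm
        rw [wProd_append, wProd_append, e, e, wB_insert hins hb, List.map_singleton,
          List.prod_singleton, mul_assoc, ← hcomm]
        simp only [mul_assoc]

theorem layer_of_isFNF {A : Type} {I : A → A → Prop} (hsym : Symmetric I) {L : List (Finset A)}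
    {u : TraceMonoid A I} (hL : IsFNF A I L u) (j : ℕ) :
    foataLayer hsym u j = (L[j]?).getD ∅ := by
  rw [hL.2]
  exact (foataAct_wProd hsym L hL.1).2.2 j

theorem layer_nonempty_iff {A : Type} {I : A → A → Prop} (hsym : Symmetric I)
    {L : List (Finset A)} {u : TraceMonoid A I} (hL : IsFNF A I L u) (j : ℕ) :
    (foataLayer hsym u j).Nonempty ↔ j < L.length := by
  rw [layer_of_isFNF hsym hL]
  by_cases h : j < L.length
  · simpa [h] using (hL.1.1 L[j] (List.getElem_mem h)).1
  · simp [h]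

theorem take_eq_of_layer_eq {A : Type} {I : A → A → Prop} (hsym : Symmetric I)
    {L M : List (Finset A)} {u v : TraceMonoid A I} (hL : IsFNF A I L u) (hM : IsFNF A I M v)
    {k : ℕ} (h : ∀ j < k, foataLayer hsym u j = foataLayer hsym v j) : L.take k = M.take k := by
  refine List.ext_getElem? fun j => ?_
  by_cases hj : j < k
  · rw [List.getElem?_take_of_lt hj, List.getElem?_take_of_lt hj]
    have h1 := layer_nonempty_iff hsym hL j
    have h2 := layer_nonempty_iff hsym hM j
    have h3 := h j hj
    rw [← h3, h1] at h2
    rw [layer_of_isFNF hsym hL, layer_of_isFNF hsym hM] at h3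
    by_cases hjL : j < L.length
    · have hjM := h2.1 hjL
      simpa [hjL, hjM] using h3
    · have hjM : ¬ j < M.length := fun h => hjL (h2.2 h)
      simp [Nat.not_lt.1 hjL, Nat.not_lt.1 hjM]
  · simp [hj]

theorem length_le_of_isFNF {A : Type} {I : A → A → Prop} (hsym : Symmetric I)
    {L M : List (Finset A)} {u : TraceMonoid A I} (hL : IsFNF A I L u) (hM : IsFNF A I M u) :
    L.length ≤ M.length := by
  by_contra! h
  exact lt_irrefl _ ((layer_nonempty_iff hsym hM _).1 ((layer_nonempty_iff hsym hL _).2 h))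

theorem bddAbove_rNat {A : Type} {I : A → A → Prop} (hsym : Symmetric I) (hirr : Irreflexive I)
    (u v : TraceMonoid A I) :
    BddAbove {k : ℕ | ∃ P Lu Lv : List (Finset A), P.length = k ∧
      IsFNF A I (P ++ Lu) u ∧ IsFNF A I (P ++ Lv) v} := by
  obtain ⟨L, hL⟩ := exists_isFNF hsym hirr u
  refine ⟨L.length, ?_⟩
  rintro k ⟨P, Lu, Lv, rfl, hu, -⟩
  have := length_le_of_isFNF hsym hu hL
  rw [List.length_append] at this
  omega

theorem exists_common_layers {A : Type} {I : A → A → Prop} (hsym : Symmetric I)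
    (hirr : Irreflexive I) (u v : TraceMonoid A I) :
    ∃ P Lu Lv : List (Finset A), P.length = rNat A I u v ∧
      IsFNF A I (P ++ Lu) u ∧ IsFNF A I (P ++ Lv) v := by
  refine Nat.sSup_mem ?_ (bddAbove_rNat hsym hirr u v)
  obtain ⟨L, hL⟩ := exists_isFNF hsym hirr u
  obtain ⟨M, hM⟩ := exists_isFNF hsym hirr v
  exact ⟨0, [], L, M, rfl, hL, hM⟩

theorem le_rNat {A : Type} {I : A → A → Prop} (hsym : Symmetric I) (hirr : Irreflexive I)
    {u v : TraceMonoid A I} (huv : u ≠ v) {k : ℕ}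
    (h : ∀ j < k, foataLayer hsym u j = foataLayer hsym v j) : k ≤ rNat A I u v := by
  obtain ⟨L, hL⟩ := exists_isFNF hsym hirr u
  obtain ⟨M, hM⟩ := exists_isFNF hsym hirr v
  have ht := take_eq_of_layer_eq hsym hL hM h
  have hk : k ≤ L.length := by
    by_contra! hlt
    have hML : ¬ L.length < M.length := by
      rw [← layer_nonempty_iff hsym hM, ← h _ hlt, layer_nonempty_iff hsym hL]
      exact lt_irrefl _
    rw [List.take_of_length_le hlt.le, List.take_of_length_le (by omega)] at ht
    exact huv (by rw [hL.2, hM.2, ht])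
  refine le_csSup (bddAbove_rNat hsym hirr u v) ⟨L.take k, L.drop k, M.drop k, by simpa, ?_, ?_⟩
  · rwa [List.take_append_drop]
  · rwa [ht, List.take_append_drop]

theorem layer_eq_of_lt_rNat {A : Type} {I : A → A → Prop} (hsym : Symmetric I)
    (hirr : Irreflexive I) {u v : TraceMonoid A I} {j : ℕ} (hj : j < rNat A I u v) :
    foataLayer hsym u j = foataLayer hsym v j := by
  obtain ⟨P, Lu, Lv, hP, hu, hv⟩ := exists_common_layers hsym hirr u v
  rw [layer_of_isFNF hsym hu, layer_of_isFNF hsym hv, List.getElem?_append_left (by omega),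
    List.getElem?_append_left (by omega)]

theorem dFNF_le_of_le_rNat {A : Type} {I : A → A → Prop} {u v u' v' : TraceMonoid A I}
    (h : u ≠ v → u' ≠ v' → rNat A I u v ≤ rNat A I u' v') (h' : u = v → u' = v') :
    dFNF A I u' v' ≤ dFNF A I u v := by
  by_cases e' : u' = v'
  · simp only [dFNF, e', if_true]
    split_ifs <;> positivity
  · have e : u ≠ v := fun e => e' (h' e)
    rw [dFNF, dFNF, if_neg e', if_neg e]
    exact zpow_le_zpow_right₀ one_le_two (by have := h e e'; omega)

/-- The condition on letters that characterizes uniform continuity. -/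
def LetterCond {A : Type} {I : A → A → Prop} (φ : Monoid.End (TraceMonoid A I)) : Prop :=
  ∀ a b c : A, (∃ w : TraceMonoid A I, φ (traceOf A I b) = traceOf A I c * w) →
    (∀ x ∈ content A I (φ (traceOf A I a)), I c x) → I a b

theorem LetterCond.height_le {A : Type} {I : A → A → Prop} (hsym : Symmetric I)
    {φ : Monoid.End (TraceMonoid A I)} (hφ : LetterCond φ) (q : TraceMonoid A I) (b c : A)
    (w : TraceMonoid A I) (hc : φ (traceOf A I b) = traceOf A I c * w) :
    foataHeight hsym q b ≤ foataHeight hsym (φ q) c := by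
  obtain ⟨l, rfl⟩ := exists_word q
  induction l using List.reverseRecOn generalizing b c w with
  | nil => simp [foataHeight, foataAct_one]
  | append_singleton l a ih =>
    have hq : ((l ++ [a]).map (traceOf A I)).prod =
        (l.map (traceOf A I)).prod * traceOf A I a := by simp
    have hmono := (ih b c w hc).trans (foataHeight_mul_le hsym _ (φ (traceOf A I a)) c)
    rw [hq, map_mul]
    by_cases hab : I b a
    · refine le_trans (le_of_eq ?_) hmono
      simp [foataHeight, foataAct_mul, foataAct_traceOf, foataStep, hab]
    · obtain ⟨l', hl', hx⟩ : ∃ l' : List A,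
          (l'.map (traceOf A I)).prod = φ (traceOf A I a) ∧ ∃ x ∈ l', ¬ I c x := by
        by_contra! hcon
        refine hab (hsym (hφ a b c ⟨w, hc⟩ ?_))
        rintro x ⟨v, hv, hxv⟩
        exact hcon v.toList (by rw [← hv, ← mk'_ofList, FreeMonoid.ofList_toList]) x hxv
      have := (foataAct_of_le_initial hsym
        (foataAct hsym (φ (l.map (traceOf A I)).prod) (fun _ => 0, fun _ => ∅))
        (foataHeight hsym (l.map (traceOf A I)).prod a) l'
        (fun d w' h => ih a d w' (hl'.symm.trans h))).1 c hx
      rw [hl', ← foataAct_mul] at this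
      have hs : foataHeight hsym ((l.map (traceOf A I)).prod * traceOf A I a) b =
          max (foataHeight hsym (l.map (traceOf A I)).prod b)
            (foataHeight hsym (l.map (traceOf A I)).prod a + 1) := by
        simp [foataHeight, foataAct_mul, foataAct_traceOf, foataStep, hab]
      rw [hs]
      exact max_le hmono this

theorem LetterCond.layer_map_mul_prod {A : Type} {I : A → A → Prop} (hsym : Symmetric I)
    {φ : Monoid.End (TraceMonoid A I)} (hφ : LetterCond φ) (q : TraceMonoid A I) {j : ℕ}
    (l : List A) (hl : ∀ b ∈ l, j < foataHeight hsym q b) :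
    foataLayer hsym (φ (q * (l.map (traceOf A I)).prod)) j = foataLayer hsym (φ q) j := by
  induction l generalizing q with
  | nil => simp
  | cons b l ih =>
    have hb : j < foataHeight hsym q b := hl b (by simp)
    rw [List.map_cons, List.prod_cons, ← mul_assoc, ih _ fun x hx =>
      (hl x (by simp [hx])).trans_le (foataHeight_mul_le hsym _ _ _), map_mul]
    exact foataLayer_mul_of_le_height hsym _ _ _ (fun c w h => hφ.height_le hsym q b c w h) hb

theorem LetterCond.layer_map_wProd {A : Type} {I : A → A → Prop} (hsym : Symmetric I)
    {φ : Monoid.End (TraceMonoid A I)} (hφ : LetterCond φ) (P L : List (Finset A))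
    (h : IsFoataChain A I (P ++ L)) {j : ℕ} (hj : j < P.length) :
    foataLayer hsym (φ (wProd A I (P ++ L))) j = foataLayer hsym (φ (wProd A I P)) j := by
  induction L using List.reverseRecOn with
  | nil => simp
  | append_singleton L B ih =>
    rw [← List.append_assoc] at h ⊢
    rw [← ih h.of_append, wProd_append (P ++ L) [B]]
    have hB : wProd A I [B] = (B.toList.map (traceOf A I)).prod := by simp [wProd, wB]
    rw [hB]
    refine hφ.layer_map_mul_prod hsym _ _ fun b hb => ?_
    rw [height_eq_length hsym h (by simpa using hb), List.length_append]
    omega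

theorem LetterCond.contraction {A : Type} {I : A → A → Prop} (hsym : Symmetric I)
    (hirr : Irreflexive I) {φ : Monoid.End (TraceMonoid A I)} (hφ : LetterCond φ)
    (u v : TraceMonoid A I) : dFNF A I (φ u) (φ v) ≤ dFNF A I u v := by
  refine dFNF_le_of_le_rNat (fun _ hne => ?_) (fun h => by rw [h])
  obtain ⟨P, Lu, Lv, hP, hu, hv⟩ := exists_common_layers hsym hirr u v
  refine le_rNat hsym hirr hne fun j hj => ?_
  rw [hu.2, hv.2, hφ.layer_map_wProd hsym P Lu hu.1 (by omega),
    hφ.layer_map_wProd hsym P Lv hv.1 (by omega)]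

theorem letterCond_of_unifCont {A : Type} {I : A → A → Prop} (hsym : Symmetric I)
    (hirr : Irreflexive I) {φ : Monoid.End (TraceMonoid A I)}
    (hφ : ∃ δ : ℝ, 0 < δ ∧ ∀ u v : TraceMonoid A I,
      dFNF A I u v < δ → dFNF A I (φ u) (φ v) < 1) : LetterCond φ := by
  rintro a b c ⟨w, hw⟩ hc
  by_contra hab
  obtain ⟨δ, hδ, h⟩ := hφ
  obtain ⟨n, hn⟩ := exists_pow_lt_of_lt_one hδ (by norm_num : (2⁻¹ : ℝ) < 1)
  have hd : dFNF A I (traceOf A I a ^ n) (traceOf A I a ^ n * traceOf A I b) < δ := by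
    by_cases e : traceOf A I a ^ n = traceOf A I a ^ n * traceOf A I b
    · rwa [dFNF, if_pos e]
    · rw [dFNF, if_neg e]
      refine lt_of_le_of_lt ?_ hn
      rw [inv_pow, ← zpow_natCast, ← zpow_neg]
      refine zpow_le_zpow_right₀ one_le_two ?_
      have : n ≤ rNat A I (traceOf A I a ^ n) (traceOf A I a ^ n * traceOf A I b) := by
        refine le_rNat hsym hirr e fun j hj => (foataLayer_mul_traceOf hsym _ b ?_).symm
        exact hj.trans_le (le_foataHeight_pow hsym hirr (fun h => hab (hsym h)) n)
      omega
  have hlt := h _ _ hd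
  obtain ⟨l, hl⟩ := exists_word (φ (traceOf A I a))
  have hcl : ∀ x ∈ l, I c x := fun x hx => hc x (by rw [← hl]; exact mem_content_of_mem hx)
  have hpow : φ (traceOf A I a ^ n) = ((List.replicate n l).flatten.map (traceOf A I)).prod := by
    rw [map_pow, ← hl, List.map_flatten, List.prod_flatten]
    simp
  have h1 : c ∉ foataLayer hsym (φ (traceOf A I a ^ n)) 0 := by
    intro hmem
    rw [hpow] at hmem
    have := foataLayer_prod_subset hsym _ _ hmem
    simp only [List.mem_toFinset, List.mem_flatten, List.mem_replicate] at this
    obtain ⟨l', ⟨-, rfl⟩, hcmem⟩ := this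
    exact hirr c (hcl c hcmem)
  have h2 : c ∈ foataLayer hsym (φ (traceOf A I a ^ n * traceOf A I b)) 0 := by
    have hcomm : Commute (traceOf A I c) (φ (traceOf A I a ^ n)) := by
      rw [map_pow, ← hl]
      exact (commute_prod hcl).pow_right n
    rw [map_mul, hw, ← mul_assoc, ← hcomm.eq, mul_assoc]
    exact mem_foataLayer_zero hsym _ _
  have hlayer : foataLayer hsym (φ (traceOf A I a ^ n)) 0 ≠
      foataLayer hsym (φ (traceOf A I a ^ n * traceOf A I b)) 0 := fun e => h1 (e ▸ h2)
  have hr : rNat A I (φ (traceOf A I a ^ n)) (φ (traceOf A I a ^ n * traceOf A I b)) = 0 := by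
    by_contra hpos
    exact hlayer (layer_eq_of_lt_rNat hsym hirr (Nat.pos_of_ne_zero hpos))
  rw [dFNF, if_neg (fun e => hlayer (by rw [e])), hr] at hlt
  norm_num at hlt

/-- For an endomorphism `φ` of the trace monoid `M(A,I)` with the Foata normal form
metric `d`, the following are equivalent: (i) `φ` is uniformly continuous;
(ii) `φ` is a contraction; (iii) for all letters `a,b,c`, if `c` is a prefix of `φ(b)`
and `c ∼_I φ(a)` then `(a,b) ∈ I`. -/
theorem unifCont_iff_contraction_iff_letterCond (A : Type) [Fintype A]
    (I : A → A → Prop) (hsym : Symmetric I) (hirr : Irreflexive I)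
    (φ : Monoid.End (TraceMonoid A I)) :
    ((∀ ε : ℝ, 0 < ε → ∃ δ : ℝ, 0 < δ ∧ ∀ u v : TraceMonoid A I,
        dFNF A I u v < δ → dFNF A I (φ u) (φ v) < ε) ↔
      (∀ u v : TraceMonoid A I, dFNF A I (φ u) (φ v) ≤ dFNF A I u v))
    ∧
    ((∀ u v : TraceMonoid A I, dFNF A I (φ u) (φ v) ≤ dFNF A I u v) ↔
      (∀ a b c : A, (∃ w : TraceMonoid A I, φ (traceOf A I b) = traceOf A I c * w) →
        (∀ x ∈ content A I (φ (traceOf A I a)), I c x) → I a b)) := by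
  have h₁ : (∀ ε : ℝ, 0 < ε → ∃ δ : ℝ, 0 < δ ∧ ∀ u v : TraceMonoid A I,
      dFNF A I u v < δ → dFNF A I (φ u) (φ v) < ε) → LetterCond φ :=
    fun h => letterCond_of_unifCont hsym hirr (h 1 one_pos)
  have h₂ : (∀ u v : TraceMonoid A I, dFNF A I (φ u) (φ v) ≤ dFNF A I u v) →
      ∀ ε : ℝ, 0 < ε → ∃ δ : ℝ, 0 < δ ∧ ∀ u v : TraceMonoid A I,
        dFNF A I u v < δ → dFNF A I (φ u) (φ v) < ε :=
    fun h ε hε => ⟨ε, hε, fun u v huv => (h u v).trans_lt huv⟩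
  exact ⟨⟨fun h => (h₁ h).contraction hsym hirr, h₂⟩,
    fun h => h₁ (h₂ h), LetterCond.contraction hsym hirr⟩
end
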